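/- arXiv:1901.01647 — 5 statements merged into one kernel-verified Lean document; each statement's English description precedes it below -/
import Mathlib

section
/- Let G be a group, let Z be a central subgroup of G, let c : G → ℝ be subadditive, and let σ_c(g) denote the limit of c(g^k)/k as k → ∞. Then σ_c(φ*z) = σ_c(φ) holds for all φ ∈ G and all z ∈ Z if and only if σ_c(z) = 0 for all z ∈ Z. -/
open Filter Topology

/-- The homogenization of a subadditive function is subadditive on commuting pairs. -/
theorem homogenization_mul_le_of_commute {G : Type*} [Group G] {c : G → ℝ}
    (hc : ∀ g h : G, c (g * h) ≤ c g + c h) {σ : G → ℝ}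
    (hσ : ∀ g : G, Tendsto (fun k : ℕ => c (g ^ k) / k) atTop (𝓝 (σ g)))
    {g h : G} (hgh : Commute g h) : σ (g * h) ≤ σ g + σ h := by
  refine le_of_tendsto_of_tendsto' (hσ (g * h)) ((hσ g).add (hσ h)) fun k => ?_
  rw [hgh.mul_pow, ← add_div]
  exact div_le_div_of_nonneg_right (hc _ _) k.cast_nonneg

/-- The homogenization of a real-valued function on a group vanishes at the identity. -/
theorem homogenization_one {G : Type*} [Group G] {c σ : G → ℝ}
    (hσ : ∀ g : G, Tendsto (fun k : ℕ => c (g ^ k) / k) atTop (𝓝 (σ g))) : σ 1 = 0 := by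
  refine tendsto_nhds_unique (hσ 1) ?_
  simpa using tendsto_const_div_atTop_nhds_zero_nat (c 1)

theorem sigma_descends_iff_vanishes_on_center {G : Type*} [Group G]
    (Z : Subgroup G) (hZ : Z ≤ Subgroup.center G)
    (c : G → ℝ)
    (hc : ∀ g h : G, c (g * h) ≤ c g + c h)
    (σ : G → ℝ)
    (hσ : ∀ g : G, Filter.Tendsto (fun k : ℕ => c (g ^ k) / k) Filter.atTop (nhds (σ g))) :
    (∀ φ : G, ∀ z ∈ Z, σ (φ * z) = σ φ) ↔ (∀ z ∈ Z, σ z = 0) := by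
  constructor
  · intro h z hz
    simpa [homogenization_one hσ] using h 1 z hz
  · intro h
    have mul_le (φ z : G) (hz : z ∈ Z) : σ (φ * z) ≤ σ φ := by
      have hcomm : Commute φ z := Subgroup.mem_center_iff.mp (hZ hz) φ
      simpa [h z hz] using homogenization_mul_le_of_commute hc hσ hcomm
    intro φ z hz
    refine (mul_le φ z hz).antisymm ?_
    simpa using mul_le (φ * z) z⁻¹ (Z.inv_mem hz)
end

section
/- Let G be a group, let c : G → ℝ be subadditive, and let f ∈ G, a ∈ ℝ, K > 0 be such that for every ψ ∈ G one has c(ψ*f*ψ⁻¹) + a ≤ K and c(ψ*f⁻¹*ψ⁻¹) − a ≤ K. Then for every φ ∈ G, the limits σ_c(f*φ) = lim_{k→∞} c((f*φ)^k)/k and σ_c(φ) = lim_{k→∞} c(φ^k)/k satisfy |σ_c(f*φ) − σ_c(φ) + a| ≤ K. -/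
open Filter Topology

/-- Replacing `φ` by `f * φ` in the `k`-th power costs at most `k` times a bound for the
subadditive function `c` on the conjugates of `f`. -/
theorem subadditive_mul_pow_le {G : Type*} [Group G] {c : G → ℝ}
    (hc : ∀ g h : G, c (g * h) ≤ c g + c h) {f : G} {M : ℝ}
    (hM : ∀ ψ : G, c (ψ * f * ψ⁻¹) ≤ M) (φ : G) (k : ℕ) (g : G) :
    c (g * (f * φ) ^ k) ≤ c (g * φ ^ k) + k * M := by
  induction k generalizing g with
  | zero => simp
  | succ k ih =>
    have hstep := ih (g * (f * φ))
    have hconj := hc (g * f * g⁻¹) (g * φ ^ (k + 1))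
    rw [show g * f * g⁻¹ * (g * φ ^ (k + 1)) = g * (f * φ) * φ ^ k by
      rw [pow_succ']; group] at hconj
    rw [pow_succ' (f * φ), ← mul_assoc]
    push_cast
    linarith [hM g]

/-- The homogenization of a subadditive function grows by at most a bound on the conjugates of
`f` under left multiplication by `f`. -/
theorem homogenization_mul_le {G : Type*} [Group G] {c : G → ℝ}
    (hc : ∀ g h : G, c (g * h) ≤ c g + c h) {σ : G → ℝ}
    (hσ : ∀ g : G, Tendsto (fun k : ℕ => c (g ^ k) / k) atTop (𝓝 (σ g)))
    {f : G} {M : ℝ} (hM : ∀ ψ : G, c (ψ * f * ψ⁻¹) ≤ M) (φ : G) :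
    σ (f * φ) ≤ σ φ + M := by
  refine le_of_tendsto_of_tendsto (hσ (f * φ)) ((hσ φ).add_const M) ?_
  filter_upwards [eventually_gt_atTop 0] with k hk
  have hk' : (0 : ℝ) < k := by exact_mod_cast hk
  have h := subadditive_mul_pow_le hc hM φ k 1
  rw [one_mul, one_mul] at h
  rw [div_add' _ _ _ hk'.ne']
  gcongr
  linarith

theorem sigma_defect_one_fragment {G : Type*} [Group G]
    (c : G → ℝ)
    (hc : ∀ g h : G, c (g * h) ≤ c g + c h)
    (σ : G → ℝ)
    (hσ : ∀ g : G, Filter.Tendsto (fun k : ℕ => c (g ^ k) / k) Filter.atTop (nhds (σ g)))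
    (f : G) (a K : ℝ) (hK : 0 < K)
    (h1 : ∀ ψ : G, c (ψ * f * ψ⁻¹) + a ≤ K)
    (h2 : ∀ ψ : G, c (ψ * f⁻¹ * ψ⁻¹) - a ≤ K) :
    ∀ φ : G, |σ (f * φ) - σ φ + a| ≤ K := by
  intro φ
  have hupper := homogenization_mul_le hc hσ (f := f) (M := K - a)
    (fun ψ => by linarith [h1 ψ]) φ
  have hlower := homogenization_mul_le hc hσ (f := f⁻¹) (M := K + a)
    (fun ψ => by linarith [h2 ψ]) (f * φ)
  rw [inv_mul_cancel_left] at hlower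
  rw [abs_le]
  constructor <;> linarith
end

section
/- Let G be a group, let c : G → ℝ be subadditive, let n be a positive integer, and let g_1, …, g_n ∈ G, a_1, …, a_n ∈ ℝ, K > 0 be such that for every index ℓ and every ψ ∈ G one has c(ψ*g_ℓ*ψ⁻¹) + a_ℓ ≤ K and c(ψ*g_ℓ⁻¹*ψ⁻¹) − a_ℓ ≤ K. Then the limit σ_c(g_1⋯g_n) of c((g_1⋯g_n)^k)/k as k → ∞ satisfies |σ_c(g_1*g_2*⋯*g_n) + (a_1 + a_2 + ⋯ + a_n)| ≤ n·K. -/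
open Filter Topology

/-- If right multiplication by each `g ℓ` changes `c` by `-a ℓ` up to an error `K`, then right
multiplication by the product changes `c` by `-∑ ℓ, a ℓ` up to an error `n * K`. -/
theorem abs_mul_prod_ofFn_sub_add_sum_le {G : Type*} [Monoid G] (c : G → ℝ) (K : ℝ) {n : ℕ}
    (g : Fin n → G) (a : Fin n → ℝ)
    (h : ∀ ℓ x, |c (x * g ℓ) - c x + a ℓ| ≤ K) (x : G) :
    |c (x * (List.ofFn g).prod) - c x + ∑ ℓ, a ℓ| ≤ n * K := by
  induction n generalizing x with
  | zero => simp
  | succ n ih =>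
    have h₀ := h 0 x
    have hs := ih (fun i => g i.succ) (fun i => a i.succ) (fun i => h i.succ) (x * g 0)
    rw [List.ofFn_succ, List.prod_cons, ← mul_assoc, Fin.sum_univ_succ]
    rw [abs_le] at *
    push_cast
    constructor <;> linarith

/-- For subadditive `c`, bounds on `c g` and `c g⁻¹` control the effect of right
multiplication by `g`. -/
theorem abs_mul_sub_add_le_of_subadditive {G : Type*} [Group G] {c : G → ℝ}
    (hc : ∀ g h : G, c (g * h) ≤ c g + c h) {g : G} {a K : ℝ}
    (h1 : c g + a ≤ K) (h2 : c g⁻¹ - a ≤ K) (x : G) :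
    |c (x * g) - c x + a| ≤ K := by
  have hu := hc x g
  have hl := hc (x * g) g⁻¹
  rw [mul_inv_cancel_right] at hl
  rw [abs_le]
  constructor <;> linarith

theorem sigma_product_estimate {G : Type*} [Group G]
    (c : G → ℝ)
    (hc : ∀ g h : G, c (g * h) ≤ c g + c h)
    (σ : G → ℝ)
    (hσ : ∀ g : G, Filter.Tendsto (fun k : ℕ => c (g ^ k) / k) Filter.atTop (nhds (σ g)))
    (n : ℕ) (hn : 0 < n)
    (g : Fin n → G) (a : Fin n → ℝ) (K : ℝ) (hK : 0 < K)
    (h1 : ∀ (ℓ : Fin n) (ψ : G), c (ψ * g ℓ * ψ⁻¹) + a ℓ ≤ K)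
    (h2 : ∀ (ℓ : Fin n) (ψ : G), c (ψ * (g ℓ)⁻¹ * ψ⁻¹) - a ℓ ≤ K) :
    |σ (List.ofFn g).prod + ∑ ℓ, a ℓ| ≤ (n : ℝ) * K := by
  have hprod := abs_mul_prod_ofFn_sub_add_sum_le c K g a fun ℓ =>
    abs_mul_sub_add_le_of_subadditive hc (by simpa using h1 ℓ 1) (by simpa using h2 ℓ 1)
  set f := (List.ofFn g).prod
  set A := ∑ ℓ, a ℓ
  have hpow (k : ℕ) : |c (f ^ k) - c 1 + k * A| ≤ k * (n * K) := by
    simpa using abs_mul_prod_ofFn_sub_add_sum_le c (n * K) (fun _ : Fin k => f) (fun _ => A)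
      (fun _ => hprod) 1
  have hlim : Tendsto (fun k : ℕ => |c (f ^ k) / k - c 1 / k + A|) atTop (𝓝 |σ f + A|) := by
    simpa using (((hσ f).sub (tendsto_const_div_atTop_nhds_zero_nat (c 1))).add_const A).abs
  refine le_of_tendsto hlim ?_
  filter_upwards [eventually_gt_atTop 0] with k hk
  have hk' : (0 : ℝ) < k := by exact_mod_cast hk
  have heq : c (f ^ k) / k - c 1 / k + A = (c (f ^ k) - c 1 + k * A) / k := by field_simp
  rw [heq, abs_div, abs_of_pos hk', div_le_iff₀' hk']
  exact hpow k
end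

section
/- Let G be a group, let c, c' : G → ℝ be subadditive, let n be a positive integer, and let g_1, …, g_n ∈ G, a_1, …, a_n ∈ ℝ, K > 0, K' > 0 be such that for every index ℓ one has c(g_ℓ) + a_ℓ ≤ K, c(g_ℓ⁻¹) − a_ℓ ≤ K, c'(g_ℓ) + a_ℓ ≤ K', and c'(g_ℓ⁻¹) − a_ℓ ≤ K'. Then the limits σ_c(w) = lim_{k→∞} c(w^k)/k and σ_{c'}(w) = lim_{k→∞} c'(w^k)/k of the product w = g_1*g_2*⋯*g_n satisfy |σ_c(w) − σ_{c'}(w)| ≤ n·(K + K'). -/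
open Filter Topology

section Subadditive

variable {G : Type*} [Group G] {c : G → ℝ}

lemma subadditive_comp_inv (hc : ∀ g h : G, c (g * h) ≤ c g + c h) (g h : G) :
    c (g * h)⁻¹ ≤ c g⁻¹ + c h⁻¹ := by
  rw [mul_inv_rev, add_comm]
  exact hc _ _

lemma subadditive_prod_ofFn_le (hc : ∀ g h : G, c (g * h) ≤ c g + c h) {n : ℕ} (hn : 0 < n)
    (g : Fin n → G) : c (List.ofFn g).prod ≤ ∑ i, c (g i) := by
  induction n, hn using Nat.le_induction with
  | base => simp
  | succ n _ ih =>
    rw [List.ofFn_succ, List.prod_cons, Fin.sum_univ_succ]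
    exact (hc _ _).trans (add_le_add_right (ih _) _)

lemma subadditive_pow_le (hc : ∀ g h : G, c (g * h) ≤ c g + c h) (g : G) {k : ℕ} (hk : 0 < k) :
    c (g ^ k) ≤ k * c g := by
  simpa using subadditive_prod_ofFn_le hc hk fun _ => g

lemma neg_subadditive_inv_le (hc : ∀ g h : G, c (g * h) ≤ c g + c h) (g : G) :
    -c g⁻¹ ≤ c g := by
  have h_one := hc 1 1
  have h_inv := hc g g⁻¹
  rw [mul_one] at h_one
  rw [mul_inv_cancel] at h_inv
  linarith

lemma limit_le_of_subadditive (hc : ∀ g h : G, c (g * h) ≤ c g + c h) {g : G} {s : ℝ}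
    (hs : Tendsto (fun k : ℕ => c (g ^ k) / k) atTop (𝓝 s)) : s ≤ c g := by
  refine le_of_tendsto hs ?_
  filter_upwards [eventually_gt_atTop 0] with k hk
  rw [div_le_iff₀' (by exact_mod_cast hk)]
  exact subadditive_pow_le hc g hk

lemma neg_inv_le_limit_of_subadditive (hc : ∀ g h : G, c (g * h) ≤ c g + c h) {g : G} {s : ℝ}
    (hs : Tendsto (fun k : ℕ => c (g ^ k) / k) atTop (𝓝 s)) : -c g⁻¹ ≤ s := by
  refine ge_of_tendsto hs ?_
  filter_upwards [eventually_gt_atTop 0] with k hk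
  rw [le_div_iff₀' (by exact_mod_cast hk)]
  have h_pow := subadditive_pow_le hc g⁻¹ hk
  rw [inv_pow] at h_pow
  linarith [neg_subadditive_inv_le hc (g ^ k)]

/-- The limit at a product of `n` elements is within `n * K` of minus the sum of the shifts. -/
lemma abs_limit_prod_add_sum_le (hc : ∀ g h : G, c (g * h) ≤ c g + c h) {n : ℕ} (hn : 0 < n)
    {g : Fin n → G} {a : Fin n → ℝ} {K s : ℝ}
    (hs : Tendsto (fun k : ℕ => c ((List.ofFn g).prod ^ k) / k) atTop (𝓝 s))
    (h : ∀ i, c (g i) + a i ≤ K) (h_inv : ∀ i, c (g i)⁻¹ - a i ≤ K) :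
    |s + ∑ i, a i| ≤ n * K := by
  have h_sum := Finset.sum_le_sum fun i (_ : i ∈ Finset.univ) => h i
  have h_inv_sum := Finset.sum_le_sum fun i (_ : i ∈ Finset.univ) => h_inv i
  simp only [Finset.sum_add_distrib, Finset.sum_sub_distrib, Finset.sum_const, Finset.card_univ,
    Fintype.card_fin, nsmul_eq_mul] at h_sum h_inv_sum
  have h_prod := subadditive_prod_ofFn_le hc hn g
  have h_inv_prod := subadditive_prod_ofFn_le (c := fun x => c x⁻¹) (subadditive_comp_inv hc) hn g
  have h_upper := limit_le_of_subadditive hc hs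
  have h_lower := neg_inv_le_limit_of_subadditive hc hs
  rw [abs_le]
  constructor <;> linarith

end Subadditive

theorem sigma_difference_product_estimate {G : Type*} [Group G]
    (c c' : G → ℝ)
    (hc : ∀ g h : G, c (g * h) ≤ c g + c h)
    (hc' : ∀ g h : G, c' (g * h) ≤ c' g + c' h)
    (σ σ' : G → ℝ)
    (hσ : ∀ g : G, Filter.Tendsto (fun k : ℕ => c (g ^ k) / k) Filter.atTop (nhds (σ g)))
    (hσ' : ∀ g : G, Filter.Tendsto (fun k : ℕ => c' (g ^ k) / k) Filter.atTop (nhds (σ' g)))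
    (n : ℕ) (hn : 0 < n)
    (g : Fin n → G) (a : Fin n → ℝ) (K K' : ℝ) (hK : 0 < K) (hK' : 0 < K')
    (h1 : ∀ ℓ : Fin n, c (g ℓ) + a ℓ ≤ K)
    (h2 : ∀ ℓ : Fin n, c (g ℓ)⁻¹ - a ℓ ≤ K)
    (h1' : ∀ ℓ : Fin n, c' (g ℓ) + a ℓ ≤ K')
    (h2' : ∀ ℓ : Fin n, c' (g ℓ)⁻¹ - a ℓ ≤ K') :
    |σ (List.ofFn g).prod - σ' (List.ofFn g).prod| ≤ (n : ℝ) * (K + K') := by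
  have h := abs_le.mp (abs_limit_prod_add_sum_le hc hn (hσ _) h1 h2)
  have h' := abs_le.mp (abs_limit_prod_add_sum_le hc' hn (hσ' _) h1' h2')
  rw [abs_le]
  constructor <;> linarith [h.1, h.2, h'.1, h'.2]
end

section
/- Let G be a group and let c, c' : G → ℝ be subadditive functions with c(g) ≤ c'(g) for all g ∈ G. If c' is a quasi-morphism, i.e., there exists C > 0 with |c'(a*b) − c'(a) − c'(b)| ≤ C for all a, b ∈ G, then c is also a quasi-morphism; explicitly, −(c'(1) + C) ≤ c(a*b) − c(a) − c(b) ≤ 0 for all a, b ∈ G. -/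
theorem subadditive_dominated_quasimorphism {G : Type*} [Group G]
    (c c' : G → ℝ)
    (hc : ∀ g h : G, c (g * h) ≤ c g + c h)
    (hc' : ∀ g h : G, c' (g * h) ≤ c' g + c' h)
    (hle : ∀ g : G, c g ≤ c' g)
    (C : ℝ) (hC : 0 < C)
    (hquasi : ∀ a b : G, |c' (a * b) - c' a - c' b| ≤ C) :
    ∀ a b : G, -(c' 1 + C) ≤ c (a * b) - c a - c b ∧ c (a * b) - c a - c b ≤ 0 := by
  intro a b
  have hab : c a ≤ c (a * b) + c b⁻¹ := by simpa using hc (a * b) b⁻¹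
  have hinv : -C ≤ c' 1 - c' b - c' b⁻¹ := by simpa using (abs_le.mp (hquasi b b⁻¹)).1
  constructor
  · linarith [hle b, hle b⁻¹]
  · linarith [hc a b]
end
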